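/- arXiv:1207.5168 — 3 statements merged into one kernel-verified Lean document; each statement's English description precedes it below -/
import Mathlib

section
/- Let y and P be positive integers, let x be a real number, and set δ = gcd(y, P). Then ∑_{n=1}^{P} ρ(y·n/P + x) = δ · ρ(P·x/δ). -/
/-- `ρ(x) = 1/2 − {x}` for `x ∉ ℤ`, `ρ(x) = 0` for `x ∈ ℤ`. -/
noncomputable def rho (x : ℝ) : ℝ := if Int.fract x = 0 then 0 else 1 / 2 - Int.fract x

theorem rho_eq_fract_sub (t : ℝ) : rho t = (Int.fract (-t) - Int.fract t) / 2 := by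
  unfold rho
  split_ifs with h
  · rw [Int.fract_neg_eq_zero.mpr h, h]; simp
  · rw [Int.fract_neg h]; ring

theorem sum_range_zmod_cast (q : ℕ) [NeZero q] (g : ZMod q → ℝ) :
    ∑ n ∈ Finset.range q, g n = ∑ k, g k := by
  refine Finset.sum_bij' (fun n _ => (n : ZMod q)) (fun k _ => k.val) ?_ ?_ ?_ ?_ ?_
  · simp
  · intro k _
    simpa using k.val_lt
  · intro n hn
    exact ZMod.val_cast_of_lt (Finset.mem_range.mp hn)
  · simp
  · simp

theorem sum_Icc_zmod_cast (q d : ℕ) [NeZero q] (g : ZMod q → ℝ) :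
    ∑ n ∈ Finset.Icc 1 (d * q), g n = d * ∑ k, g k := by
  have shift : ∑ n ∈ Finset.Icc 1 (d * q), g n =
      ∑ n ∈ Finset.range (d * q), g ((n : ZMod q) + 1) := by
    rw [Finset.range_eq_Ico, ← Finset.Ico_add_one_right_eq_Icc]
    have := Finset.sum_Ico_add' (fun n : ℕ => g n) 0 (d * q) 1
    simpa using this.symm
  rw [shift, ← Equiv.sum_comp (Equiv.addRight (1 : ZMod q)) g]
  clear shift
  induction d with
  | zero => simp
  | succ d ih =>
    rw [add_mul, one_mul, Finset.sum_range_add, ih]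
    have := sum_range_zmod_cast q (fun k => g (k + 1))
    simp only [Nat.cast_add, Nat.cast_mul, CharP.cast_eq_zero, mul_zero, zero_add, this,
      Equiv.coe_addRight]
    push_cast
    ring

theorem fract_int_add_div (q : ℕ) [NeZero q] (m : ℤ) {θ : ℝ} (h0 : 0 ≤ θ) (h1 : θ < 1) :
    Int.fract ((m + θ) / q) = (((m : ZMod q).val : ℝ) + θ) / q := by
  have hq : (0 : ℝ) < q := by exact_mod_cast NeZero.pos q
  rw [Int.fract_eq_iff]
  refine ⟨by positivity, ?_, m / q, ?_⟩
  · rw [div_lt_one hq]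
    have : ((m : ZMod q).val : ℝ) + 1 ≤ q := by exact_mod_cast (m : ZMod q).val_lt
    linarith
  · have hv : (((m : ZMod q).val : ℤ) : ℝ) = ((m % q : ℤ) : ℝ) := by
      rw [ZMod.val_intCast]
    have hm : ((m % q : ℤ) : ℝ) + q * ((m / q : ℤ) : ℝ) = m := by
      exact_mod_cast Int.emod_add_mul_ediv m q
    rw [Int.cast_natCast] at hv
    rw [hv, ← hm]
    field_simp
    ring

theorem sum_zmod_val (q : ℕ) [NeZero q] :
    ∑ k : ZMod q, (k.val : ℝ) = q * (q - 1) / 2 := by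
  rw [← sum_range_zmod_cast q (fun k => (k.val : ℝ)), Finset.sum_congr rfl
    (fun n hn => by rw [ZMod.val_cast_of_lt (Finset.mem_range.mp hn)])]
  have := Finset.sum_range_id_mul_two q
  have hq : 1 ≤ q := NeZero.pos q
  have h : (∑ n ∈ Finset.range q, (n : ℝ)) * 2 = q * (q - 1) := by
    have h := congrArg (Nat.cast : ℕ → ℝ) this
    push_cast [Nat.cast_sub hq] at h
    exact h
  linarith

theorem sum_fract_of_isUnit (q d : ℕ) [NeZero q] (a : ℤ) (ha : IsUnit (a : ZMod q)) (x : ℝ) :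
    ∑ n ∈ Finset.Icc 1 (d * q), Int.fract ((a : ℝ) * n / q + x) =
      d * (((q : ℝ) - 1) / 2 + Int.fract (q * x)) := by
  have hq : (q : ℝ) ≠ 0 := NeZero.ne _
  set k := ⌊q * x⌋ with hk
  set θ := Int.fract (q * x) with hθ
  have hx : (q : ℝ) * x = k + θ := (Int.floor_add_fract _).symm
  have key (n : ℕ) : Int.fract ((a : ℝ) * n / q + x) =
      (((a : ZMod q) * n + k).val + θ) / q := by
    have h := fract_int_add_div q (a * n + k) (Int.fract_nonneg (q * x))
      (Int.fract_lt_one (q * x))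
    push_cast at h
    rw [← h]
    congr 1
    field_simp
    rw [← hθ]
    linarith
  simp_rw [key]
  rw [sum_Icc_zmod_cast q d (fun n => (((a : ZMod q) * n + k).val + θ) / q)]
  have bij := Equiv.sum_comp (ha.unit.mulLeft.trans (Equiv.addRight (k : ZMod q)))
    (fun n => ((n.val : ℝ) + θ) / q)
  simp only [Equiv.trans_apply, Units.mulLeft_apply, IsUnit.unit_spec,
    Equiv.coe_addRight] at bij
  rw [bij, ← Finset.sum_div, Finset.sum_add_distrib, sum_zmod_val]
  simp only [Finset.sum_const, Finset.card_univ, ZMod.card, nsmul_eq_mul]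
  field_simp

/-- `∑_{n=1}^{P} ρ(yn/P + x) = (y,P) · ρ(Px/(y,P))`. -/
theorem rho_sum_eq (y P : ℕ) (hy : 0 < y) (hP : 0 < P) (x : ℝ) :
    ∑ n ∈ Finset.Icc 1 P, rho ((y : ℝ) * n / P + x) =
      (Nat.gcd y P : ℝ) * rho ((P : ℝ) * x / (Nat.gcd y P : ℝ)) := by
  have hd : 0 < Nat.gcd y P := Nat.gcd_pos_of_pos_left _ hy
  obtain ⟨a, q, hcop, hya, hPq⟩ := Nat.exists_coprime y P
  generalize Nat.gcd y P = d at *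
  subst hya hPq
  have : NeZero q := ⟨by rintro rfl; simp at hP⟩
  have hq : (q : ℝ) ≠ 0 := NeZero.ne _
  have hd0 : (d : ℝ) ≠ 0 := by exact_mod_cast hd.ne'
  have hu : IsUnit ((a : ℤ) : ZMod q) := by
    simpa using (ZMod.isUnit_iff_coprime a q).mpr hcop
  have hpos := sum_fract_of_isUnit q d a hu x
  have hneg := sum_fract_of_isUnit q d (-a) (by simpa using hu) (-x)
  have hterm (n : ℕ) : rho (((a * d : ℕ) : ℝ) * n / (q * d : ℕ) + x) =
      (Int.fract (((-a : ℤ) : ℝ) * n / q + -x) - Int.fract (((a : ℤ) : ℝ) * n / q + x)) / 2 := by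
    have h : ((a * d : ℕ) : ℝ) * n / (q * d : ℕ) + x = ((a : ℤ) : ℝ) * n / q + x := by
      push_cast
      field_simp
    rw [h, rho_eq_fract_sub]
    congr 3
    push_cast
    ring
  have hx : ((q * d : ℕ) : ℝ) * x / d = q * x := by
    push_cast
    field_simp
  rw [hx, rho_eq_fract_sub, Finset.sum_congr rfl (fun n _ => hterm n), mul_comm q d,
    ← Finset.sum_div, Finset.sum_sub_distrib, hpos, hneg, mul_neg]
  ring
end

section
/- Let y₁, y₂ be positive integers with gcd(y₁, y₂) = 1, let P be a positive integer, and let t be a real number. Set δ₁ = gcd(y₁, P), δ₂ = gcd(y₂, P), y₃ = y₁/δ₁, y₄ = y₂/δ₂, and P₂ = P/(δ₁·δ₂) (note that δ₁·δ₂ divides P, since δ₁ and δ₂ are coprime divisors of P). Then ∑_{n=1}^{P} ρ(y₁·n/P + t)·ρ(y₂·n/P + t) = ∑_{n=1}^{P₂} ρ(y₃·n/P₂ + δ₂·t)·ρ(y₄·n/P₂ + δ₁·t). -/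
theorem rho_add_int (x : ℝ) (n : ℤ) : rho (x + n) = rho x := by
  simp only [rho, Int.fract_add_intCast]

theorem rho_of_mem_Ico {x : ℝ} (h0 : 0 ≤ x) (h1 : x < 1) :
    rho x = if x = 0 then 0 else 1 / 2 - x := by
  rw [rho, Int.fract_eq_self.2 ⟨h0, h1⟩]

theorem sum_range_eq_sum_zmod (q : ℕ) [NeZero q] (G : ZMod q → ℝ) :
    ∑ k ∈ Finset.range q, G k = ∑ z, G z := by
  refine Finset.sum_bij' (fun k _ => (k : ZMod q)) (fun z _ => z.val) ?_ ?_ ?_ ?_ ?_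
  · simp
  · intro z _
    simpa using ZMod.val_lt z
  · intro k hk
    exact ZMod.val_cast_of_lt (Finset.mem_range.1 hk)
  · intro z _
    simp
  · simp

/-- Summing a `q`-periodic function over a complete residue system `u k + j`, `k < q`. -/
theorem sum_range_affine {q : ℕ} [NeZero q] {u : ℕ} (hu : Nat.Coprime u q) (j : ℤ)
    {F : ℤ → ℝ} (hF : Function.Periodic F (q : ℤ)) :
    ∑ k ∈ Finset.range q, F (u * k + j) = ∑ k ∈ Finset.range q, F k := by
  have key (n : ℤ) : F n = F ((n : ZMod q).val : ℤ) := by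
    rw [ZMod.val_intCast, Int.emod_def, mul_comm]
    exact (hF.sub_int_mul_eq (n / q)).symm
  have e1 : ∑ k ∈ Finset.range q, F (u * k + j) =
      ∑ z : ZMod q, F ((u * z + j : ZMod q).val : ℤ) := by
    rw [← sum_range_eq_sum_zmod q fun z => F ((u * z + j : ZMod q).val : ℤ)]
    refine Finset.sum_congr rfl fun k _ => ?_
    rw [key]
    push_cast
    rfl
  have e2 : ∑ k ∈ Finset.range q, F k = ∑ z : ZMod q, F (z.val : ℤ) := by
    rw [← sum_range_eq_sum_zmod q fun z => F (z.val : ℤ)]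
    refine Finset.sum_congr rfl fun k _ => ?_
    rw [key]
    push_cast
    rfl
  rw [e1, e2]
  exact Equiv.sum_comp ((Units.mulLeft (ZMod.unitOfCoprime u hu)).trans (Equiv.addRight (j : ZMod q)))
    fun z : ZMod q => F (z.val : ℤ)

theorem sum_rho_of_lt {q : ℕ} (hq : 0 < q) {y : ℝ} (h0 : 0 ≤ y) (h1 : y < 1) :
    ∑ k ∈ Finset.range q, rho ((y + k) / q) = rho y := by
  have hq' : (0 : ℝ) < q := by exact_mod_cast hq
  have hterm : ∀ k ∈ Finset.range q,
      rho ((y + k) / q) = if y + k = 0 then 0 else 1 / 2 - (y + k) / q := by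
    intro k hk
    have hk' : (k : ℝ) + 1 ≤ q := by exact_mod_cast Finset.mem_range.1 hk
    rw [rho_of_mem_Ico (by positivity) (by rw [div_lt_one hq']; linarith)]
    simp [hq'.ne']
  rw [Finset.sum_congr rfl hterm, rho_of_mem_Ico h0 h1]
  have hsum (m : ℕ) : ∑ k ∈ Finset.range m, (1 / 2 - (y + k) / q) =
      m / 2 - (m * y + m * (m - 1) / 2) / q := by
    induction m with
    | zero => simp
    | succ m ih =>
      rw [Finset.sum_range_succ, ih]
      push_cast
      field_simp
      ring
  have hsplit : ∀ k ∈ Finset.range q,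
      (if y + k = 0 then (0 : ℝ) else 1 / 2 - (y + k) / q) =
        (1 / 2 - (y + k) / q) - if k = 0 then (if y = 0 then 1 / 2 else 0) else 0 := by
    intro k _
    rcases Nat.eq_zero_or_pos k with rfl | hk
    · by_cases hy : y = 0 <;> simp [hy]
    · have : (0 : ℝ) < k := by exact_mod_cast hk
      rw [if_neg (by positivity), if_neg hk.ne', sub_zero]
  rw [Finset.sum_congr rfl hsplit, Finset.sum_sub_distrib, hsum, Finset.sum_ite_eq',
    if_pos (Finset.mem_range.2 hq)]
  by_cases hy : y = 0
  · simp only [hy, if_true]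
    field_simp
    ring
  · simp only [hy, if_false]
    field_simp
    ring

/-- The distribution relation for `rho`, over a complete residue system `u k`, `k < q`. -/
theorem sum_rho_add_mul_div {q : ℕ} (hq : 0 < q) {u : ℕ} (hu : Nat.Coprime u q) (x : ℝ) :
    ∑ k ∈ Finset.range q, rho (x + u * k / q) = rho (q * x) := by
  have : NeZero q := ⟨hq.ne'⟩
  have hq' : (q : ℝ) ≠ 0 := by exact_mod_cast hq.ne'
  have hF : Function.Periodic (fun n : ℤ => rho ((Int.fract (q * x) + n) / q)) (q : ℤ) := by
    intro n
    have : (Int.fract (q * x) + ((n + q : ℤ) : ℝ)) / q =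
        (Int.fract (q * x) + n) / q + (1 : ℤ) := by
      push_cast
      field_simp
      ring
    simp only [this, rho_add_int]
  have h := sum_range_affine hu ⌊q * x⌋ hF
  have hr : rho (q * x) = rho (Int.fract (q * x)) := by
    rw [rho, rho, Int.fract_fract]
  rw [hr, ← sum_rho_of_lt hq (Int.fract_nonneg _) (Int.fract_lt_one _)]
  refine Eq.trans (Finset.sum_congr rfl fun k _ => ?_) (h.trans ?_)
  · congr 1
    push_cast
    rw [Int.fract]
    field_simp
    ring
  · simp

theorem sum_range_mul_mod {a b : ℕ} (ha : 0 < a) (hb : 0 < b) (hab : Nat.Coprime a b)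
    (f g : ℕ → ℝ) :
    ∑ k ∈ Finset.range (a * b), f (k % a) * g (k % b) =
      (∑ i ∈ Finset.range a, f i) * ∑ j ∈ Finset.range b, g j := by
  rw [Finset.sum_mul_sum, ← Finset.sum_product']
  refine Finset.sum_bij' (fun k _ => (k % a, k % b))
    (fun p _ => (Nat.chineseRemainder hab p.1 p.2 : ℕ)) ?_ ?_ ?_ ?_ ?_
  · intro k _
    simp [Nat.mod_lt, ha, hb]
  · intro p _
    exact Finset.mem_range.2 (Nat.chineseRemainder_lt_mul hab _ _ ha.ne' hb.ne')
  · intro k hk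
    have h := (Nat.chineseRemainder_modEq_unique hab (Nat.mod_modEq k a).symm
      (Nat.mod_modEq k b).symm)
    exact (Nat.ModEq.eq_of_lt_of_lt h (Finset.mem_range.1 hk)
      (Nat.chineseRemainder_lt_mul hab _ _ ha.ne' hb.ne')).symm
  · intro p hp
    simp only [Finset.mem_product, Finset.mem_range] at hp
    have h := (Nat.chineseRemainder hab p.1 p.2).2
    refine Prod.ext ?_ ?_
    · exact Nat.mod_eq_of_modEq h.1 hp.1
    · exact Nat.mod_eq_of_modEq h.2 hp.2
  · simp

theorem sum_Icc_mul (F : ℕ → ℝ) (m d : ℕ) :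
    ∑ n ∈ Finset.Icc 1 (d * m), F n =
      ∑ n ∈ Finset.Icc 1 m, ∑ k ∈ Finset.range d, F (n + m * k) := by
  have hIcc (N : ℕ) (G : ℕ → ℝ) :
      ∑ n ∈ Finset.Icc 1 N, G n = ∑ n ∈ Finset.range N, G (n + 1) := by
    induction N with
    | zero => simp
    | succ N ih => rw [Finset.sum_Icc_succ_top (by omega), ih, Finset.sum_range_succ]
  rw [hIcc, hIcc, Finset.sum_comm]
  induction d with
  | zero => simp
  | succ d ih =>
    rw [Nat.succ_mul, Finset.sum_range_add, ih, Finset.sum_range_succ]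
    congr 1
    refine Finset.sum_congr rfl fun i _ => ?_
    congr 1
    ring

theorem rho_add_mul_mod_div (x : ℝ) (u k q : ℕ) (hq : 0 < q) :
    rho (x + u * k / q) = rho (x + u * (k % q : ℕ) / q) := by
  have hq' : (q : ℝ) ≠ 0 := by exact_mod_cast hq.ne'
  have hk : (k : ℝ) = (k % q : ℕ) + q * (k / q : ℕ) := by
    exact_mod_cast (Nat.mod_add_div k q).symm
  have : x + u * k / q = x + u * (k % q : ℕ) / q + (((u * (k / q) : ℕ) : ℤ) : ℝ) := by
    rw [hk, Int.cast_natCast, Nat.cast_mul]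
    field_simp
    ring
  rw [this, rho_add_int]

/-- with `δ₁ = (y₁,P)`, `δ₂ = (y₂,P)`, `y₃ = y₁/δ₁`, `y₄ = y₂/δ₂`,
`P₂ = P/(δ₁δ₂)`, one has
`∑_{n=1}^{P} ρ(y₁n/P + t)ρ(y₂n/P + t) = ∑_{n=1}^{P₂} ρ(y₃n/P₂ + δ₂t)ρ(y₄n/P₂ + δ₁t)`. -/
theorem rho_product_sum_reduction (y₁ y₂ P : ℕ) (h₁ : 0 < y₁) (h₂ : 0 < y₂)
    (hco : Nat.Coprime y₁ y₂) (hP : 0 < P) (t : ℝ)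
    (δ₁ δ₂ y₃ y₄ P₂ : ℕ)
    (hδ₁ : δ₁ = Nat.gcd y₁ P) (hδ₂ : δ₂ = Nat.gcd y₂ P)
    (hy₃ : y₁ = δ₁ * y₃) (hy₄ : y₂ = δ₂ * y₄) (hP₂ : P = δ₁ * δ₂ * P₂) :
    ∑ n ∈ Finset.Icc 1 P, rho ((y₁ : ℝ) * n / P + t) * rho ((y₂ : ℝ) * n / P + t) =
      ∑ n ∈ Finset.Icc 1 P₂,
        rho ((y₃ : ℝ) * n / P₂ + (δ₂ : ℝ) * t) * rho ((y₄ : ℝ) * n / P₂ + (δ₁ : ℝ) * t) := by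
  have hδ : 0 < δ₁ * δ₂ * P₂ := hP₂ ▸ hP
  have pP : 0 < P₂ := Nat.pos_of_ne_zero fun h => by simp [h] at hδ
  have p₁ : 0 < δ₁ := Nat.pos_of_ne_zero fun h => by simp [h] at hδ
  have p₂ : 0 < δ₂ := Nat.pos_of_ne_zero fun h => by simp [h] at hδ
  have c : Nat.Coprime (δ₁ * y₃) (δ₂ * y₄) := hy₃ ▸ hy₄ ▸ hco
  have c₁ : Nat.Coprime y₃ δ₂ := c.coprime_mul_left.coprime_mul_right_right
  have c₂ : Nat.Coprime y₄ δ₁ := c.symm.coprime_mul_left.coprime_mul_right_right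
  have c₃ : Nat.Coprime δ₂ δ₁ := c.symm.coprime_mul_right.coprime_mul_right_right
  have r₁ : (δ₁ : ℝ) ≠ 0 := by exact_mod_cast p₁.ne'
  have r₂ : (δ₂ : ℝ) ≠ 0 := by exact_mod_cast p₂.ne'
  have rP : (P₂ : ℝ) ≠ 0 := by exact_mod_cast pP.ne'
  clear hδ₁ hδ₂
  subst hy₃ hy₄ hP₂
  rw [mul_comm δ₁ δ₂, sum_Icc_mul]
  refine Finset.sum_congr rfl fun n _ => ?_
  have e₁ : (y₃ : ℝ) * n / P₂ + δ₂ * t = δ₂ * (y₃ * n / (δ₂ * P₂) + t) := by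
    field_simp
  have e₂ : (y₄ : ℝ) * n / P₂ + δ₁ * t = δ₁ * (y₄ * n / (δ₁ * P₂) + t) := by
    field_simp
  rw [e₁, e₂, ← sum_rho_add_mul_div p₂ c₁, ← sum_rho_add_mul_div p₁ c₂,
    ← sum_range_mul_mod p₂ p₁ c₃]
  refine Finset.sum_congr rfl fun k _ => ?_
  rw [← rho_add_mul_mod_div _ _ _ _ p₂, ← rho_add_mul_mod_div _ _ _ _ p₁]
  congr 2
  all_goals
    push_cast
    field_simp
    ring
end

section
/- Let P₂ be a positive integer, c an integer with gcd(c, P₂) = 1, and let c⁻¹ be an integer with c·c⁻¹ ≡ 1 (mod P₂). For z ∈ ℤ define V(z) = ∑_{m=1}^{P₂} ρ(m/P₂)·ρ((c·m + z)/P₂). Then for every integer z, V(z) − V(z−1) = −(1/2)·(ρ(c⁻¹·z/P₂) + ρ(c⁻¹·(z−1)/P₂)). -/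
/-- `V(z) = ∑_{m=1}^{P₂} ρ(m/P₂)·ρ((cm+z)/P₂)`. -/
noncomputable def Vded (P₂ : ℕ) (c z : ℤ) : ℝ :=
  ∑ m ∈ Finset.Icc 1 P₂, rho ((m : ℝ) / P₂) * rho (((c * m + z : ℤ) : ℝ) / P₂)

theorem rho_neg (x : ℝ) : rho (-x) = -rho x := by
  unfold rho
  by_cases h : Int.fract x = 0
  · simp [h, Int.fract_neg_eq_zero]
  · rw [if_neg h, if_neg (by rwa [Int.fract_neg_eq_zero]), Int.fract_neg h]
    ring

theorem rho_eq_of_fract_eq {x y : ℝ} (h : Int.fract x = Int.fract y) : rho x = rho y := by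
  simp only [rho, h]

/-- The function `k ↦ ρ(k / n)` on residues modulo `n`. -/
noncomputable def rhoZMod (n : ℕ) (x : ZMod n) : ℝ := rho ((x.val : ℝ) / n)

theorem rho_intCast_div (n : ℕ) [NeZero n] (k : ℤ) :
    rho ((k : ℝ) / n) = rhoZMod n (k : ZMod n) := by
  have hn : (n : ℝ) ≠ 0 := NeZero.ne _
  apply rho_eq_of_fract_eq
  rw [Int.fract_eq_fract]
  refine ⟨k / n, ?_⟩
  have h : (((k : ZMod n).val : ℤ) : ℝ) = ((k % n : ℤ) : ℝ) := by rw [ZMod.val_intCast]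
  have h' : ((k % n + n * (k / n) : ℤ) : ℝ) = k := by rw [Int.emod_add_mul_ediv]
  push_cast at h h'
  rw [h, ← sub_div, div_eq_iff hn]
  linarith

theorem rhoZMod_neg (n : ℕ) [NeZero n] (x : ZMod n) : rhoZMod n (-x) = -rhoZMod n x := by
  obtain ⟨k, rfl⟩ := ZMod.intCast_surjective x
  rw [← Int.cast_neg, ← rho_intCast_div, ← rho_intCast_div, ← rho_neg, Int.cast_neg, neg_div]

theorem sum_rhoZMod (n : ℕ) [NeZero n] : ∑ x, rhoZMod n x = 0 := by
  have h := Equiv.sum_comp (Equiv.neg (ZMod n)) (rhoZMod n)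
  simp only [Equiv.neg_apply, rhoZMod_neg, Finset.sum_neg_distrib] at h
  linarith

theorem rhoZMod_zero (n : ℕ) : rhoZMod n 0 = 0 := by
  simp [rhoZMod, rho]

theorem rho_natCast_div {n k : ℕ} (hk : 0 < k) (hkn : k < n) :
    rho ((k : ℝ) / n) = 1 / 2 - k / n := by
  have hk' : (0 : ℝ) < k := by exact_mod_cast hk
  have hn : (0 : ℝ) < n := by exact_mod_cast hk.trans hkn
  have h : Int.fract ((k : ℝ) / n) = k / n :=
    Int.fract_eq_self.2 ⟨by positivity, (div_lt_one hn).2 (by exact_mod_cast hkn)⟩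
  rw [rho, h, if_neg (by positivity)]

theorem rhoZMod_natCast {n k : ℕ} (hk : 0 < k) (hkn : k < n) :
    rhoZMod n k = 1 / 2 - k / n := by
  rw [rhoZMod, ZMod.val_cast_of_lt hkn, rho_natCast_div hk hkn]

theorem rhoZMod_sub_rhoZMod_sub_one (n : ℕ) [NeZero n] (x : ZMod n) :
    rhoZMod n x - rhoZMod n (x - 1) =
      -1 / n + 1 / 2 * ((if x = 0 then 1 else 0) + (if x = 1 then 1 else 0)) := by
  have hn : (n : ℝ) ≠ 0 := NeZero.ne _
  obtain rfl | hn1 : n = 1 ∨ 1 < n := by have := NeZero.pos n; lia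
  · have h : ∀ y : ZMod 1, y = 0 := fun y => Subsingleton.elim _ _
    rw [h x, h (0 - 1), if_pos rfl, if_pos (h 1).symm]
    norm_num
  have : Fact (1 < n) := ⟨hn1⟩
  have h1 : rhoZMod n 1 = 1 / 2 - 1 / n := by
    simpa using rhoZMod_natCast (n := n) one_pos hn1
  by_cases hx0 : x = 0
  · subst hx0
    rw [zero_sub, rhoZMod_neg, rhoZMod_zero, h1, if_pos rfl, if_neg zero_ne_one]
    ring
  by_cases hx1 : x = 1
  · subst hx1
    rw [sub_self, rhoZMod_zero, h1, if_pos rfl, if_neg one_ne_zero]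
    ring
  obtain ⟨k, hk, rfl⟩ : ∃ k < n, (k : ZMod n) = x := ⟨x.val, x.val_lt, ZMod.natCast_zmod_val x⟩
  have hk0 : k ≠ 0 := by rintro rfl; simp at hx0
  have hk1 : k ≠ 1 := by rintro rfl; simp at hx1
  obtain ⟨j, rfl⟩ : ∃ j, k = j + 1 := ⟨k - 1, by lia⟩
  rw [if_neg hx0, if_neg hx1, rhoZMod_natCast (by lia) hk]
  have hj : ((j + 1 : ℕ) : ZMod n) - 1 = j := by push_cast; ring
  rw [hj, rhoZMod_natCast (by lia) (by lia)]
  push_cast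
  ring

theorem ZMod.sum_Icc_one_natCast {M : Type*} [AddCommMonoid M] (n : ℕ) [NeZero n]
    (F : ZMod n → M) : ∑ m ∈ Finset.Icc 1 n, F (m : ZMod n) = ∑ x, F x := by
  have hinj : Set.InjOn (fun m : ℕ => (m : ZMod n)) (Finset.Icc 1 n) := by
    intro a ha b hb hab
    simp only [Finset.coe_Icc, Set.mem_Icc] at ha hb
    have h : ((a : ℤ) - b) % n = 0 := by
      rw [← Int.dvd_iff_emod_eq_zero, ← ZMod.intCast_zmod_eq_zero_iff_dvd]
      push_cast
      exact sub_eq_zero.2 hab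
    obtain ⟨d, hd⟩ := Int.dvd_of_emod_eq_zero h
    have h1 : d < 1 := by by_contra!; nlinarith
    have h2 : -1 < d := by by_contra!; nlinarith
    obtain rfl : d = 0 := by lia
    lia
  rw [← Finset.sum_image (f := F) hinj]
  congr 1
  apply Finset.eq_univ_of_card
  rw [Finset.card_image_of_injOn hinj, Nat.card_Icc, ZMod.card, Nat.add_sub_cancel]

theorem Vded_eq_sum_rhoZMod (n : ℕ) [NeZero n] (c z : ℤ) :
    Vded n c z = ∑ x : ZMod n, rhoZMod n x * rhoZMod n (c * x + z) := by
  rw [Vded, ← ZMod.sum_Icc_one_natCast n fun x => rhoZMod n x * rhoZMod n (c * x + z)]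
  refine Finset.sum_congr rfl fun m _ => ?_
  have h := rho_intCast_div n m
  push_cast at h
  rw [h, rho_intCast_div]
  push_cast
  rfl

/-- `V(z) − V(z−1) = −(1/2)(ρ(c⁻¹z/P₂) + ρ(c⁻¹(z−1)/P₂))`. -/
theorem Vded_difference (P₂ : ℕ) (hP₂ : 0 < P₂) (c cinv : ℤ)
    (hc : IsCoprime c (P₂ : ℤ)) (hcinv : c * cinv ≡ 1 [ZMOD (P₂ : ℤ)]) (z : ℤ) :
    Vded P₂ c z - Vded P₂ c (z - 1) =
      -(1 / 2) * (rho (((cinv * z : ℤ) : ℝ) / P₂) + rho (((cinv * (z - 1) : ℤ) : ℝ) / P₂)) := by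
  have : NeZero P₂ := ⟨hP₂.ne'⟩
  have hinv : (c : ZMod P₂) * cinv = 1 := by
    exact_mod_cast (ZMod.intCast_eq_intCast_iff _ _ _).2 hcinv
  have hsolve (x w : ZMod P₂) : c * x + w = 0 ↔ x = -(cinv * w) := by
    constructor <;> intro h
    · linear_combination (cinv : ZMod P₂) * h - x * hinv
    · rw [h]; linear_combination -w * hinv
  have hterm (x : ZMod P₂) :
      rhoZMod P₂ x * rhoZMod P₂ (c * x + z) - rhoZMod P₂ x * rhoZMod P₂ (c * x + (z - 1 : ℤ)) =
        -1 / P₂ * rhoZMod P₂ x + 1 / 2 * ((if x = -(cinv * z) then rhoZMod P₂ x else 0) +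
          (if x = -(cinv * (z - 1)) then rhoZMod P₂ x else 0)) := by
    have h1 : (c * x + z = 1) ↔ x = -(cinv * (z - 1)) := by
      rw [← hsolve, ← add_sub_assoc, sub_eq_zero]
    have h := rhoZMod_sub_rhoZMod_sub_one P₂ (c * x + z)
    simp only [hsolve, h1] at h
    rw [← mul_sub, Int.cast_sub, Int.cast_one, ← add_sub_assoc, h]
    split_ifs <;> ring
  rw [Vded_eq_sum_rhoZMod, Vded_eq_sum_rhoZMod, ← Finset.sum_sub_distrib,
    Finset.sum_congr rfl fun x _ => hterm x, Finset.sum_add_distrib, ← Finset.mul_sum,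
    ← Finset.mul_sum, Finset.sum_add_distrib, sum_rhoZMod, Finset.sum_ite_eq', Finset.sum_ite_eq',
    if_pos (Finset.mem_univ _), if_pos (Finset.mem_univ _), rhoZMod_neg, rhoZMod_neg,
    rho_intCast_div, rho_intCast_div]
  push_cast
  ring
end
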